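/- Let k ≥ 1. For the Closed Geodetic Game on the odd cycle C_{2k+1}, for every vertex u one has 𝒢(C_{2k+1}, {u}) = 0. -/

import Mathlib

open SimpleGraph

/-- mex: least nonnegative integer not in the set. -/
noncomputable def mex (X : Set ℕ) : ℕ := sInf Xᶜ

/-- The interval `I(u,v)`: vertices on some shortest `u`–`v` path. -/
def geodInterval {V : Type*} (G : SimpleGraph V) (u v : V) : Set V :=
  {w | G.dist u w + G.dist w v = G.dist u v}

/-- The geodetic closure `(S)`. -/
def geodClosure {V : Type*} (G : SimpleGraph V) (S : Set V) : Set V :=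
  ⋃ u ∈ S, ⋃ v ∈ S, geodInterval G u v

/-- Sprague–Grundy value of the Closed Geodetic Game on `G` with selected set `S`. -/
noncomputable def grundy {V : Type*} [Fintype V] [DecidableEq V]
    (G : SimpleGraph V) (S : Finset V) : ℕ :=
  mex (Set.range fun v : {v : V // v ∉ geodClosure G ↑S} =>
    grundy G (insert v.1 S))
termination_by Sᶜ.card
decreasing_by
  have hv : (v : V) ∉ S := by
    intro h
    exact v.2 (Set.mem_biUnion (by simpa using h)
      (Set.mem_biUnion (by simpa using h) (by simp [geodInterval])))
  simp only [Finset.compl_insert]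
  exact Finset.card_erase_lt_of_mem (by simpa using hv)

theorem mex_eq_zero_of_notMem {X : Set ℕ} (h : 0 ∉ X) : mex X = 0 :=
  Nat.sInf_eq_zero.2 (Or.inl h)

theorem mex_ne_zero_of_mem {X : Set ℕ} (hfin : X.Finite) (h : 0 ∈ X) : mex X ≠ 0 := by
  intro h0
  rcases Nat.sInf_eq_zero.1 h0 with h1 | h1
  · exact h1 h
  · exact hfin.infinite_compl.nonempty.ne_empty h1

section Grundy

variable {V : Type*} [Fintype V] [DecidableEq V] {G : SimpleGraph V} {S : Finset V}

theorem grundy_eq_zero (h : ∀ v ∉ geodClosure G (S : Set V), grundy G (insert v S) ≠ 0) :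
    grundy G S = 0 := by
  rw [grundy]
  refine mex_eq_zero_of_notMem ?_
  rintro ⟨v, hv⟩
  exact h v.1 v.2 hv

theorem grundy_ne_zero {v : V} (hv : v ∉ geodClosure G (S : Set V))
    (h : grundy G (insert v S) = 0) : grundy G S ≠ 0 := by
  rw [grundy]
  exact mex_ne_zero_of_mem (Set.finite_range _) ⟨⟨v, hv⟩, h⟩

end Grundy

theorem mem_geodClosure {V : Type*} {G : SimpleGraph V} {S : Set V} {w : V} :
    w ∈ geodClosure G S ↔ ∃ u ∈ S, ∃ v ∈ S, G.dist u w + G.dist w v = G.dist u v := by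
  simp [geodClosure, geodInterval]

theorem cycleGraph_adj_iff_val {n : ℕ} {u v : Fin n} :
    (cycleGraph n).Adj u v ↔ u ≠ v ∧ (u.val + 1 = v.val ∨ v.val + 1 = u.val ∨
      (u.val = 0 ∧ v.val + 1 = n) ∨ (v.val = 0 ∧ u.val + 1 = n)) := by
  have hu := u.2
  have hv := v.2
  rw [cycleGraph_adj', ne_eq, Fin.ext_iff]
  rcases le_total u v with h | h
  · rcases h.eq_or_lt with rfl | h'
    · have : NeZero n := ⟨by omega⟩
      simp
    · rw [Fin.coe_sub_iff_le.2 h, Fin.coe_sub_iff_lt.2 h']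
      rw [Fin.lt_def] at h'
      omega
  · rcases h.eq_or_lt with rfl | h'
    · have : NeZero n := ⟨by omega⟩
      simp
    · rw [Fin.coe_sub_iff_le.2 h, Fin.coe_sub_iff_lt.2 h']
      rw [Fin.lt_def] at h'
      omega

theorem cycleGraph_min_le_length {n : ℕ} {u v : Fin n} (p : (cycleGraph n).Walk u v) :
    min ((u.val - v.val) + (v.val - u.val)) (n - ((u.val - v.val) + (v.val - u.val)))
      ≤ p.length := by
  induction p with
  | nil => simp
  | @cons a b c h p ih =>
    have ha := a.2
    have hb := b.2
    have hc := c.2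
    rw [cycleGraph_adj_iff_val] at h
    rw [Walk.length_cons]
    omega

theorem cycleGraph_dist_le_sub {n : ℕ} {u v : Fin n} (h : u.val ≤ v.val) :
    (cycleGraph n).dist u v ≤ v.val - u.val := by
  obtain ⟨m, hm⟩ := Nat.exists_eq_add_of_le h
  induction m generalizing v with
  | zero =>
    obtain rfl : u = v := Fin.ext (by omega)
    simp
  | succ m ih =>
    have hv := v.2
    obtain ⟨n, rfl⟩ : ∃ n', n = n' + 1 := ⟨n - 1, by omega⟩
    let w : Fin (n + 1) := ⟨u.val + m, by omega⟩
    have hw : w.val = u.val + m := rfl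
    have hwv : (cycleGraph (n + 1)).Adj w v := by
      rw [cycleGraph_adj_iff_val, ne_eq, Fin.ext_iff]
      omega
    have h1 := ih (v := w) (by omega) hw
    have h2 := cycleGraph_connected.dist_triangle (u := u) (v := w) (w := v)
    rw [dist_eq_one_iff_adj.2 hwv] at h2
    omega

theorem cycleGraph_dist_le_compl {n : ℕ} {u v : Fin n} (h : u.val ≤ v.val) :
    (cycleGraph n).dist u v ≤ n - (v.val - u.val) := by
  have hv := v.2
  obtain ⟨n, rfl⟩ : ∃ n', n = n' + 1 := ⟨n - 1, by omega⟩
  have h0 : (0 : Fin (n + 1)).val = 0 := rfl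
  have hl : (Fin.last n).val = n := rfl
  have h1 := cycleGraph_dist_le_sub (u := 0) (v := u) (by omega)
  have h2 := cycleGraph_dist_le_sub (u := v) (v := Fin.last n) (by omega)
  have h3 : (cycleGraph (n + 1)).dist 0 (Fin.last n) ≤ 1 := by
    rcases eq_or_ne (0 : Fin (n + 1)) (Fin.last n) with h | h
    · simp [← h]
    · refine (dist_eq_one_iff_adj.2 ?_).le
      rw [cycleGraph_adj_iff_val]
      exact ⟨h, by omega⟩
  have h4 := cycleGraph_connected.dist_triangle (u := u) (v := 0) (w := v)
  have h5 := cycleGraph_connected.dist_triangle (u := 0) (v := Fin.last n) (w := v)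
  rw [dist_comm] at h1 h2
  omega

theorem cycleGraph_dist {n : ℕ} (u v : Fin n) :
    (cycleGraph n).dist u v =
      min ((u.val - v.val) + (v.val - u.val)) (n - ((u.val - v.val) + (v.val - u.val))) := by
  apply le_antisymm
  · rcases le_total u.val v.val with h | h
    · have h1 := cycleGraph_dist_le_sub h
      have h2 := cycleGraph_dist_le_compl h
      omega
    · have h1 := cycleGraph_dist_le_sub h
      have h2 := cycleGraph_dist_le_compl h
      rw [dist_comm] at h1 h2
      omega
  · have hu := u.2
    obtain ⟨n, rfl⟩ : ∃ n', n = n' + 1 := ⟨n - 1, by omega⟩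
    obtain ⟨p, hp⟩ := cycleGraph_connected.exists_walk_length_eq_dist u v
    exact hp ▸ cycleGraph_min_le_length p

/-- Three vertices cutting an odd cycle into arcs of length at most half have full closure. -/
theorem mem_geodClosure_oddCycle {k : ℕ} {S : Set (Fin (2 * k + 1))} {x y z : Fin (2 * k + 1)}
    (hx : x ∈ S) (hy : y ∈ S) (hz : z ∈ S) (hxy : x.val ≤ y.val) (hyz : y.val ≤ z.val)
    (hxy' : y.val ≤ x.val + k) (hyz' : z.val ≤ y.val + k) (hxz : x.val + k < z.val)
    (w : Fin (2 * k + 1)) : w ∈ geodClosure (cycleGraph (2 * k + 1)) S := by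
  have hw := w.2
  have hz' := z.2
  rw [mem_geodClosure]
  by_cases h1 : w.val < x.val ∨ z.val < w.val
  · refine ⟨x, hx, z, hz, ?_⟩
    simp only [cycleGraph_dist]
    omega
  · by_cases h2 : w.val ≤ y.val
    · refine ⟨x, hx, y, hy, ?_⟩
      simp only [cycleGraph_dist]
      omega
    · refine ⟨y, hy, z, hz, ?_⟩
      simp only [cycleGraph_dist]
      omega

/-- Any two vertices of an odd cycle extend by a vertex outside their closure to a set with
full closure. -/
theorem exists_geodClosure_oddCycle_full {k : ℕ} {a b : Fin (2 * k + 1)} (hab : a.val < b.val) :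
    ∃ w ∉ geodClosure (cycleGraph (2 * k + 1)) {a, b}, ∀ S : Set (Fin (2 * k + 1)),
      a ∈ S → b ∈ S → w ∈ S → ∀ t, t ∈ geodClosure (cycleGraph (2 * k + 1)) S := by
  have ha := a.2
  have hb := b.2
  have key : ∀ w : Fin (2 * k + 1),
      (b.val ≤ a.val + k ∧ (w.val = a.val + k + 1 ∨ w.val + k = a.val)) ∨
        (a.val + k < b.val ∧ w.val = a.val + k) →
      w ∉ geodClosure (cycleGraph (2 * k + 1)) {a, b} := by
    intro w hw
    have hw' := w.2
    rw [mem_geodClosure]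
    rintro ⟨u, rfl | rfl, v, rfl | rfl, h⟩ <;> simp only [cycleGraph_dist] at h <;> omega
  by_cases h : b.val ≤ a.val + k
  · by_cases h' : a.val + k + 1 < 2 * k + 1
    · refine ⟨⟨a.val + k + 1, h'⟩, key _ (Or.inl ⟨h, Or.inl rfl⟩), fun S hS hS' hw t => ?_⟩
      exact mem_geodClosure_oddCycle hS hS' hw hab.le (by simp; omega) h (by simp; omega)
        (by simp) t
    · refine ⟨⟨a.val - k, by omega⟩, key _ (Or.inl ⟨h, Or.inr (by simp; omega)⟩),
        fun S hS hS' hw t => ?_⟩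
      exact mem_geodClosure_oddCycle hw hS hS' (by simp) (by omega) (by simp; omega)
        (by omega) (by simp; omega) t
  · refine ⟨⟨a.val + k, by omega⟩, key _ (Or.inr ⟨by omega, rfl⟩), fun S hS hS' hw t => ?_⟩
    exact mem_geodClosure_oddCycle hS hw hS' (by simp) (by simp; omega) (by simp)
      (by simp; omega) (by omega) t

/-- on the odd cycle `C_{2k+1}` (`k ≥ 1`), the Grundy value of the Closed
Geodetic Game position with one vertex `u` selected is `0`. -/
theorem grundy_odd_cycle_one_vertex (k : ℕ) (hk : 1 ≤ k) (u : Fin (2 * k + 1)) :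
    grundy (SimpleGraph.cycleGraph (2 * k + 1)) ({u} : Finset (Fin (2 * k + 1))) = 0 := by
  refine grundy_eq_zero fun v hv => ?_
  have hne : u ≠ v := by
    rintro rfl
    exact hv (mem_geodClosure.2 ⟨u, by simp, u, by simp, by simp⟩)
  obtain ⟨w, hw, hfull⟩ : ∃ w ∉ geodClosure (cycleGraph (2 * k + 1)) {v, u},
      ∀ S : Set (Fin (2 * k + 1)), v ∈ S → u ∈ S → w ∈ S →
        ∀ t, t ∈ geodClosure (cycleGraph (2 * k + 1)) S := by
    rcases lt_or_gt_of_ne (Fin.val_ne_of_ne hne) with h | h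
    · obtain ⟨w, hw, hfull⟩ := exists_geodClosure_oddCycle_full h
      exact ⟨w, Set.pair_comm u v ▸ hw, fun S hv hu => hfull S hu hv⟩
    · exact exists_geodClosure_oddCycle_full h
  refine grundy_ne_zero (v := w) (by simpa using hw) (grundy_eq_zero fun t ht => ?_)
  exact absurd (hfull _ (by simp) (by simp) (by simp) t) ht
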